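/- Kendall's tau of the Gumbel copula with parameter $\theta \geq 1$, defined as $\kappa_\tau = 4 \int_0^1 \int_0^1 C(u, v; \theta) \, dC(u, v; \theta) - 1$, equals $1 - 1/\theta$. -/

import Mathlib

open Real Set intervalIntegral

/-- The bivariate Gumbel copula. -/
noncomputable def gumbelCopula (θ u v : ℝ) : ℝ :=
  Real.exp (-(((-Real.log u) ^ θ + (-Real.log v) ^ θ) ^ (1 / θ)))

/-- The Gumbel copula density `c(u, v; θ) = ∂²C/∂u∂v`. -/
noncomputable def gumbelDensity (θ u v : ℝ) : ℝ :=
  deriv (fun v' => deriv (fun u' => gumbelCopula θ u' v') u) v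

open MeasureTheory Filter Topology

noncomputable def gK (θ w : ℝ) : ℝ := Real.exp (-2 * w) * w ^ (1 - θ)

noncomputable def gG (θ x : ℝ) : ℝ := ∫ w in Ioi x, gK θ w

noncomputable def gPhi (θ x : ℝ) : ℝ := gK θ x - gG θ x

lemma gK_nonneg (θ w : ℝ) (hw : 0 < w) : 0 ≤ gK θ w := by unfold gK; positivity

lemma gK_cont (θ w : ℝ) (hw : 0 < w) : ContinuousAt (gK θ) w := by
  unfold gK
  exact (by fun_prop : ContinuousAt (fun w : ℝ => Real.exp (-2 * w)) w).mul
    (Real.continuousAt_rpow_const w _ (Or.inl hw.ne'))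

lemma gK_meas (θ : ℝ) : Measurable (gK θ) := by
  unfold gK; fun_prop

lemma gK_le (θ : ℝ) (hθ : 1 ≤ θ) (x w : ℝ) (hx : 0 < x) (hw : x < w) :
    gK θ w ≤ x ^ (1 - θ) * Real.exp (-2 * w) := by
  unfold gK
  rw [mul_comm]
  exact mul_le_mul_of_nonneg_right
    (Real.rpow_le_rpow_of_nonpos hx hw.le (by linarith)) (Real.exp_pos _).le

lemma gK_int (θ : ℝ) (hθ : 1 ≤ θ) (x : ℝ) (hx : 0 < x) : IntegrableOn (gK θ) (Ioi x) := by
  have h := (integrableOn_exp_mul_Ioi (a := -2) (by norm_num) x).const_mul (x ^ (1 - θ))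
  refine Integrable.mono' h (gK_meas θ).aestronglyMeasurable ?_
  refine (ae_restrict_iff' measurableSet_Ioi).2 (ae_of_all _ fun w hw => ?_)
  have hw : x < w := hw
  rw [Real.norm_of_nonneg (gK_nonneg θ w (hx.trans hw))]
  exact gK_le θ hθ x w hx hw

lemma gG_nonneg (θ x : ℝ) (hx : 0 < x) : 0 ≤ gG θ x :=
  setIntegral_nonneg measurableSet_Ioi fun w hw => gK_nonneg θ w (hx.trans hw)

lemma gG_le (θ : ℝ) (hθ : 1 ≤ θ) (x : ℝ) (hx : 0 < x) : gG θ x ≤ gK θ x / 2 := by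
  have h := (integrableOn_exp_mul_Ioi (a := -2) (by norm_num) x).const_mul (x ^ (1 - θ))
  have := setIntegral_mono_on (gK_int θ hθ x hx) h measurableSet_Ioi
    (fun w hw => gK_le θ hθ x w hx hw)
  rw [MeasureTheory.integral_const_mul, integral_exp_mul_Ioi (by norm_num)] at this
  unfold gG
  refine this.trans (le_of_eq ?_)
  unfold gK; ring

lemma gG_deriv (θ : ℝ) (hθ : 1 ≤ θ) (x : ℝ) (hx : 0 < x) :
    HasDerivAt (gG θ) (-gK θ x) x := by
  have hi : IntervalIntegrable (gK θ) volume 1 x := by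
    refine ContinuousOn.intervalIntegrable fun w hw => (gK_cont θ w ?_).continuousWithinAt
    rw [Set.mem_uIcc] at hw
    rcases hw with h | h <;> linarith [h.1]
  have h := (intervalIntegral.integral_hasDerivAt_right hi
    ((gK_meas θ).stronglyMeasurable.stronglyMeasurableAtFilter) (gK_cont θ x hx)).const_sub (gG θ 1)
  refine h.congr_of_eventuallyEq ?_
  filter_upwards [lt_mem_nhds hx] with z hz
  have := intervalIntegral.integral_Ioi_sub_Ioi' (gK_int θ hθ 1 one_pos) (gK_int θ hθ z hz)
  unfold gG
  linarith

lemma gPhi_nonneg (θ : ℝ) (hθ : 1 ≤ θ) (x : ℝ) (hx : 0 < x) : 0 ≤ gPhi θ x := by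
  have := gG_le θ hθ x hx
  have := gK_nonneg θ x hx
  unfold gPhi; linarith

lemma gPhi_deriv (θ : ℝ) (hθ : 1 ≤ θ) (x : ℝ) (hx : 0 < x) :
    HasDerivAt (gPhi θ) (-(Real.exp (-2 * x) * (x ^ (1 - θ) + (θ - 1) * x ^ (-θ)))) x := by
  have h1 : HasDerivAt (fun w : ℝ => Real.exp (-2 * w)) (Real.exp (-2 * x) * (-2 * 1)) x :=
    ((hasDerivAt_id x).const_mul (-2)).exp
  have h2 := (hasDerivAt_id x).rpow_const (p := 1 - θ) (Or.inl hx.ne')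
  have h3 := (h1.mul h2).sub (gG_deriv θ hθ x hx)
  refine h3.congr_deriv ?_
  have : 1 - θ - 1 = -θ := by ring
  simp only [id, this, gK]
  ring

lemma gPhi_tendsto (θ : ℝ) (hθ : 1 ≤ θ) : Tendsto (gPhi θ) atTop (𝓝 0) := by
  have h : Tendsto (fun w : ℝ => Real.exp (-w)) atTop (𝓝 0) := Real.tendsto_exp_neg_atTop_nhds_zero
  refine tendsto_of_tendsto_of_tendsto_of_le_of_le' tendsto_const_nhds h ?_ ?_
  · filter_upwards [eventually_ge_atTop 1] with w hw using gPhi_nonneg θ hθ w (by linarith)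
  · filter_upwards [eventually_ge_atTop 1] with w hw
    have h1 := gG_nonneg θ w (by linarith)
    have h2 : w ^ (1 - θ) ≤ 1 := Real.rpow_le_one_of_one_le_of_nonpos hw (by linarith)
    have h3 : Real.exp (-2 * w) ≤ Real.exp (-w) := Real.exp_le_exp.2 (by linarith)
    have h4 : Real.exp (-2 * w) * w ^ (1 - θ) ≤ Real.exp (-2 * w) * 1 :=
      mul_le_mul_of_nonneg_left h2 (Real.exp_pos _).le
    unfold gPhi gK
    linarith

lemma int_subst (f : ℝ → ℝ) :
    ∫ u in (0 : ℝ)..1, f u = ∫ y in Ioi (0 : ℝ), Real.exp (-y) * f (Real.exp (-y)) := by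
  have him : (fun y : ℝ => Real.exp (-y)) '' Ioi 0 = Ioo 0 1 := by
    ext z
    constructor
    · rintro ⟨y, hy, rfl⟩
      exact ⟨Real.exp_pos _, Real.exp_lt_one_iff.2 (by have : 0 < y := hy; linarith)⟩
    · rintro ⟨h0, h1⟩
      refine ⟨-Real.log z, ?_, ?_⟩
      · have := Real.log_neg h0 h1
        simpa using this
      · simp [Real.exp_log h0]
  have hd : ∀ y ∈ Ioi (0 : ℝ), HasDerivWithinAt (fun y : ℝ => Real.exp (-y))
      (Real.exp (-y) * (-1)) (Ioi 0) y := fun y _ =>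
    ((hasDerivAt_id y).neg.exp).hasDerivWithinAt
  have hinj : InjOn (fun y : ℝ => Real.exp (-y)) (Ioi 0) := by
    intro a _ b _ h
    simpa using h
  rw [intervalIntegral.integral_of_le zero_le_one, MeasureTheory.integral_Ioc_eq_integral_Ioo, ← him,
    integral_image_eq_integral_abs_deriv_smul measurableSet_Ioi hd hinj]
  simp

lemma dens_eq (θ x y : ℝ) (hθ : 1 ≤ θ) (hx : 0 < x) (hy : 0 < y) :
    gumbelDensity θ (Real.exp (-x)) (Real.exp (-y)) =
      Real.exp (-((x ^ θ + y ^ θ) ^ (1 / θ))) * (x ^ (θ - 1) * y ^ (θ - 1)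
        / (Real.exp (-x) * Real.exp (-y))) *
        ((x ^ θ + y ^ θ) ^ (1 / θ - 1) * (x ^ θ + y ^ θ) ^ (1 / θ - 1)
          + (θ - 1) * (x ^ θ + y ^ θ) ^ (1 / θ - 1 - 1)) := by
  have hθ0 : θ ≠ 0 := by linarith
  set u := Real.exp (-x) with hu
  have hu0 : u ≠ 0 := (Real.exp_pos _).ne'
  have hlu : -Real.log u = x := by simp [hu]
  have hD : ∀ᶠ v in 𝓝 (Real.exp (-y)), deriv (fun u' => gumbelCopula θ u' v) u =
      Real.exp (-((x ^ θ + (-Real.log v) ^ θ) ^ (1 / θ))) *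
        (x ^ θ + (-Real.log v) ^ θ) ^ (1 / θ - 1) * (x ^ (θ - 1) / u) := by
    filter_upwards [lt_mem_nhds (Real.exp_pos (-y)),
      gt_mem_nhds (Real.exp_lt_one_iff.2 (by linarith : -y < 0))] with v hv0 hv1
    have hl : 0 < -Real.log v := by have := Real.log_neg hv0 hv1; linarith
    have hS : x ^ θ + (-Real.log v) ^ θ ≠ 0 := by positivity
    have h1 := (Real.hasDerivAt_log hu0).neg.rpow_const (p := θ) (Or.inr hθ)
    have h2 := (h1.add_const ((-Real.log v) ^ θ)).rpow_const (p := 1 / θ)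
      (Or.inl (by simp only [Pi.neg_apply, hlu]; exact hS))
    have h3 := h2.neg.exp.deriv
    simp only [Pi.neg_apply, hlu] at h3
    unfold gumbelCopula
    refine h3.trans ?_
    field_simp
  unfold gumbelDensity
  rw [Filter.EventuallyEq.deriv_eq hD]
  have hv0 : Real.exp (-y) ≠ 0 := (Real.exp_pos _).ne'
  have hlv : -Real.log (Real.exp (-y)) = y := by simp
  have hS : x ^ θ + y ^ θ ≠ 0 := by positivity
  have h1 := ((Real.hasDerivAt_log hv0).neg.rpow_const (p := θ) (Or.inr hθ)).const_add (x ^ θ)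
  have h2 := h1.rpow_const (p := 1 / θ)
      (Or.inl (by simp only [Pi.neg_apply, hlv]; exact hS))
  have h2' := h1.rpow_const (p := 1 / θ - 1)
      (Or.inl (by simp only [Pi.neg_apply, hlv]; exact hS))
  have h3 := ((h2.neg.exp.mul h2').mul_const (x ^ (θ - 1) / u)).deriv
  simp only [Pi.neg_apply, hlv] at h3
  refine h3.trans ?_
  generalize (x ^ θ + y ^ θ) ^ (1 / θ - 1 - 1) = A
  generalize (x ^ θ + y ^ θ) ^ (1 / θ - 1) = B
  field_simp
  ring

lemma inner_eq (θ x : ℝ) (hθ : 1 ≤ θ) (hx : 0 < x) :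
    ∫ v in (0 : ℝ)..1, gumbelCopula θ (Real.exp (-x)) v * gumbelDensity θ (Real.exp (-x)) v
      = x ^ (θ - 1) / Real.exp (-x) * gPhi θ x := by
  have hθ0 : θ ≠ 0 := by linarith
  rw [int_subst]
  have hd : ∀ y ∈ Ici (0 : ℝ), HasDerivAt
      (fun y => -(x ^ (θ - 1) / Real.exp (-x)) * gPhi θ ((x ^ θ + y ^ θ) ^ (1 / θ)))
      (-(x ^ (θ - 1) / Real.exp (-x)) *
        (-(Real.exp (-2 * (x ^ θ + y ^ θ) ^ (1 / θ)) * (((x ^ θ + y ^ θ) ^ (1 / θ)) ^ (1 - θ)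
          + (θ - 1) * ((x ^ θ + y ^ θ) ^ (1 / θ)) ^ (-θ))) *
        (1 * θ * y ^ (θ - 1) * (1 / θ) * (x ^ θ + y ^ θ) ^ (1 / θ - 1)))) y := by
    intro y hy
    have hy : 0 ≤ y := hy
    have hS : 0 < x ^ θ + y ^ θ := by positivity
    have h1 := (((hasDerivAt_id y).rpow_const (p := θ) (Or.inr hθ)).const_add (x ^ θ)).rpow_const
      (p := 1 / θ) (Or.inl hS.ne')
    exact ((gPhi_deriv θ hθ _ (by positivity)).comp y h1).const_mul _
  have hnn : ∀ y ∈ Ioi (0 : ℝ), 0 ≤ (-(x ^ (θ - 1) / Real.exp (-x)) *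
        (-(Real.exp (-2 * (x ^ θ + y ^ θ) ^ (1 / θ)) * (((x ^ θ + y ^ θ) ^ (1 / θ)) ^ (1 - θ)
          + (θ - 1) * ((x ^ θ + y ^ θ) ^ (1 / θ)) ^ (-θ))) *
        (1 * θ * y ^ (θ - 1) * (1 / θ) * (x ^ θ + y ^ θ) ^ (1 / θ - 1)))) := by
    intro y hy
    have hy : 0 < y := hy
    have : 0 ≤ θ - 1 := by linarith
    have h0 : 0 < θ := by linarith
    rw [neg_mul, neg_mul, mul_neg, neg_neg]
    positivity
  have hlim : Tendsto
      (fun y : ℝ => -(x ^ (θ - 1) / Real.exp (-x)) * gPhi θ ((x ^ θ + y ^ θ) ^ (1 / θ)))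
      atTop (𝓝 (-(x ^ (θ - 1) / Real.exp (-x)) * 0)) := by
    refine ((gPhi_tendsto θ hθ).comp ?_).const_mul _
    exact (tendsto_rpow_atTop (by positivity)).comp
      (tendsto_atTop_add_const_left _ _ (tendsto_rpow_atTop (by linarith)))
  have key := integral_Ioi_of_hasDerivAt_of_nonneg' hd hnn hlim
  have e0 : (x ^ θ + (0 : ℝ) ^ θ) ^ (1 / θ) = x := by
    rw [Real.zero_rpow hθ0, add_zero, one_div, Real.rpow_rpow_inv hx.le hθ0]
  rw [e0] at key
  have : x ^ (θ - 1) / Real.exp (-x) * gPhi θ x = -(x ^ (θ - 1) / Real.exp (-x)) * 0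
    - -(x ^ (θ - 1) / Real.exp (-x)) * gPhi θ x := by ring
  rw [this, ← key]
  refine setIntegral_congr_fun measurableSet_Ioi fun y hy => ?_
  have hy : 0 < y := hy
  have hS : 0 < x ^ θ + y ^ θ := by positivity
  beta_reduce
  rw [dens_eq θ x y hθ hx hy]
  unfold gumbelCopula
  simp only [Real.log_exp, neg_neg]
  set S := x ^ θ + y ^ θ
  have e1 : (S ^ (1 / θ)) ^ (1 - θ) = S ^ (1 / θ - 1) := by
    rw [← Real.rpow_mul hS.le]; congr 1; field_simp
  have e2 : S ^ (1 / θ - 1 - 1) = (S ^ (1 / θ)) ^ (-θ) * S ^ (1 / θ - 1) := by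
    rw [← Real.rpow_mul hS.le, ← Real.rpow_add hS]; congr 1; field_simp; ring
  have e3 : Real.exp (-2 * S ^ (1 / θ)) = Real.exp (-S ^ (1 / θ)) * Real.exp (-S ^ (1 / θ)) := by
    rw [← Real.exp_add]; congr 1; ring
  rw [e1, e2, e3]
  have := (Real.exp_pos (-y)).ne'
  have := (Real.exp_pos (-x)).ne'
  generalize S ^ (1 / θ - 1) = A
  generalize (S ^ (1 / θ)) ^ (-θ) = B
  generalize Real.exp (-S ^ (1 / θ)) = E
  field_simp

lemma xG_bound (θ : ℝ) (hθ : 1 ≤ θ) (x : ℝ) (hx : 0 < x) :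
    0 ≤ x ^ θ * gG θ x ∧ x ^ θ * gG θ x ≤ x * Real.exp (-2 * x) := by
  have h1 := gG_nonneg θ x hx
  have h2 := gG_le θ hθ x hx
  have hp : 0 < x ^ θ := by positivity
  refine ⟨by positivity, ?_⟩
  have h3 := mul_le_mul_of_nonneg_left h2 hp.le
  have e : x ^ θ * x ^ (1 - θ) = x := by
    rw [← Real.rpow_add hx]; simp
  have e2 : x ^ θ * (gK θ x / 2) = x * Real.exp (-2 * x) / 2 := by
    unfold gK
    calc _ = (x ^ θ * x ^ (1 - θ)) * Real.exp (-2 * x) / 2 := by ring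
      _ = _ := by rw [e]
  have : 0 < x * Real.exp (-2 * x) := by positivity
  linarith

lemma outer_eq (θ : ℝ) (hθ : 1 ≤ θ) :
    ∫ x in Ioi (0 : ℝ), x ^ (θ - 1) * gPhi θ x = 1 / 2 - 1 / (4 * θ) := by
  have hθ0 : θ ≠ 0 := by linarith
  have hlx : Tendsto (fun x : ℝ => x * Real.exp (-2 * x)) atTop (𝓝 0) := by
    have h := Real.tendsto_pow_mul_exp_neg_atTop_nhds_zero 1
    refine tendsto_of_tendsto_of_tendsto_of_le_of_le' tendsto_const_nhds h ?_ ?_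
    · filter_upwards [eventually_ge_atTop 0] with w hw
      positivity
    · filter_upwards [eventually_ge_atTop 0] with w hw
      rw [pow_one]
      exact mul_le_mul_of_nonneg_left (Real.exp_le_exp.2 (by linarith)) hw
  have hle : Tendsto (fun x : ℝ => Real.exp (-2 * x)) atTop (𝓝 0) :=
    Real.tendsto_exp_atBot.comp (tendsto_id.const_mul_atTop_of_neg (by norm_num))
  have hxG : Tendsto (fun x : ℝ => x ^ θ * gG θ x) atTop (𝓝 0) := by
    refine tendsto_of_tendsto_of_tendsto_of_le_of_le' tendsto_const_nhds hlx ?_ ?_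
    · filter_upwards [eventually_gt_atTop 0] with w hw using (xG_bound θ hθ w hw).1
    · filter_upwards [eventually_gt_atTop 0] with w hw using (xG_bound θ hθ w hw).2
  have hxG0 : ContinuousWithinAt (fun x : ℝ => x ^ θ * gG θ x) (Ici 0) 0 := by
    have hc : Tendsto (fun x : ℝ => x * Real.exp (-2 * x)) (𝓝[Ici 0] 0) (𝓝 0) := by
      have : Continuous (fun x : ℝ => x * Real.exp (-2 * x)) := by fun_prop
      have := (this.tendsto 0).mono_left (nhdsWithin_le_nhds (s := Ici 0))
      simpa using this
    have hz : (0 : ℝ) ^ θ * gG θ 0 = 0 := by rw [Real.zero_rpow hθ0, zero_mul]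
    unfold ContinuousWithinAt
    beta_reduce
    rw [hz]
    refine tendsto_of_tendsto_of_tendsto_of_le_of_le' tendsto_const_nhds hc ?_ ?_
    · filter_upwards [self_mem_nhdsWithin] with w hw
      rcases eq_or_lt_of_le (show (0 : ℝ) ≤ w from hw) with h | h
      · rw [← h, hz]
      · exact (xG_bound θ hθ w h).1
    · filter_upwards [self_mem_nhdsWithin] with w hw
      rcases eq_or_lt_of_le (show (0 : ℝ) ≤ w from hw) with h | h
      · rw [← h, hz]; simp
      · exact (xG_bound θ hθ w h).2
  have key := integral_Ioi_of_hasDerivAt_of_nonneg (a := 0)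
    (l := (-1 / 2) * 0 - (1 / θ) * 0 + ((1 / (2 * θ)) * 0 + (1 / (4 * θ)) * 0))
    (g := fun x => (-1 / 2) * Real.exp (-2 * x) - (1 / θ) * (x ^ θ * gG θ x)
      + ((1 / (2 * θ)) * (x * Real.exp (-2 * x)) + (1 / (4 * θ)) * Real.exp (-2 * x)))
    (g' := fun x => x ^ (θ - 1) * gPhi θ x) ?_ ?_ ?_ ?_
  · rw [key, Real.zero_rpow hθ0]
    simp
    ring
  · refine ContinuousWithinAt.add (ContinuousWithinAt.sub ?_ (hxG0.const_mul _)) ?_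
    · exact (by fun_prop : Continuous fun x : ℝ => (-1 / 2) * Real.exp (-2 * x)).continuousWithinAt
    · exact (by fun_prop : Continuous fun x : ℝ => (1 / (2 * θ)) * (x * Real.exp (-2 * x))
        + (1 / (4 * θ)) * Real.exp (-2 * x)).continuousWithinAt
  · intro x hx
    have hx : 0 < x := hx
    have h1 : HasDerivAt (fun w : ℝ => Real.exp (-2 * w)) (Real.exp (-2 * x) * (-2 * 1)) x :=
      ((hasDerivAt_id x).const_mul (-2)).exp
    have h2 := (hasDerivAt_id x).rpow_const (p := θ) (Or.inr hθ)
    have h3 := ((h1.const_mul (-1 / 2)).sub ((h2.mul (gG_deriv θ hθ x hx)).const_mul (1 / θ))).add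
      ((((hasDerivAt_id x).mul h1).const_mul (1 / (2 * θ))).add (h1.const_mul (1 / (4 * θ))))
    refine h3.congr_deriv ?_
    have e1 : x ^ (1 - θ) = (x ^ (θ - 1))⁻¹ := by
      rw [← Real.rpow_neg hx.le]; congr 1; ring
    have e2 : x ^ θ = x ^ (θ - 1) * x := by
      rw [← Real.rpow_add_one hx.ne']; congr 1; ring
    simp only [id, gPhi, gK]
    rw [e1, e2]
    have : x ^ (θ - 1) ≠ 0 := (Real.rpow_pos_of_pos hx _).ne'
    field_simp
    ring
  · intro x hx
    have hx : 0 < x := hx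
    have := gPhi_nonneg θ hθ x hx
    positivity
  · exact ((hle.const_mul _).sub (hxG.const_mul _)).add ((hlx.const_mul _).add (hle.const_mul _))

/-- Kendall's tau of the Gumbel copula,
`κ_τ = 4 ∫₀¹ ∫₀¹ C(u, v; θ) c(u, v; θ) du dv - 1`, equals `1 - 1/θ`. -/
theorem stmt_13 (θ : ℝ) (hθ : 1 ≤ θ) :
    4 * (∫ u in (0 : ℝ)..1, ∫ v in (0 : ℝ)..1,
        gumbelCopula θ u v * gumbelDensity θ u v) - 1
      = 1 - 1 / θ := by
  have hθ0 : θ ≠ 0 := by linarith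
  rw [int_subst]
  have : ∫ x in Ioi (0 : ℝ), Real.exp (-x) * ∫ v in (0 : ℝ)..1,
      gumbelCopula θ (Real.exp (-x)) v * gumbelDensity θ (Real.exp (-x)) v
      = ∫ x in Ioi (0 : ℝ), x ^ (θ - 1) * gPhi θ x := by
    refine setIntegral_congr_fun measurableSet_Ioi fun x hx => ?_
    beta_reduce
    rw [inner_eq θ x hθ hx]
    have := (Real.exp_pos (-x)).ne'
    field_simp
  rw [this, outer_eq θ hθ]
  field_simp
  ring
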